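/- Let μ be a Borel probability measure on the unit sphere S² ⊂ ℝ³, and define h_μ on the open unit ball B ⊂ ℝ³ by h_μ(x) := −(1/2)·∫_{S²} log((1−|x|²)/|x−ζ|²) dμ(ζ). Then the hyperbolic Laplacian of h_μ is constant: (1−|x|²)²·Δ h_μ(x) + 2(1−|x|²)·(x · ∇h_μ(x)) = 4 for all x ∈ B, where Δ and ∇ are the Euclidean Laplacian and gradient on ℝ³. -/

import Mathlib

noncomputable section
open MeasureTheory Metric
open scoped RealInnerProductSpace

/-- `ℝ³` with the Euclidean norm. -/
abbrev E3 : Type := EuclideanSpace ℝ (Fin 3)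

/-- Second derivative of `h` at `x`, twice in the direction `v`. -/
def dd (h : E3 → ℝ) (x v : E3) : ℝ := fderiv ℝ (fun y => fderiv ℝ h y v) x v

/-- Euclidean Laplacian on `ℝ³`: sum of the pure second partials. -/
def eucLap (h : E3 → ℝ) (x : E3) : ℝ :=
  ∑ i : Fin 3, dd h x (EuclideanSpace.single i 1)

section ParametricIntegral

variable {K E : Type*} [TopologicalSpace K] [CompactSpace K] [MeasurableSpace K]
  [OpensMeasurableSpace K] [NormedAddCommGroup E]

theorem integrable_of_continuous_compactSpace (μ : Measure K) [IsFiniteMeasure μ] {f : K → E}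
    (hf : Continuous f) : Integrable f μ :=
  hf.integrable_of_hasCompactSupport (HasCompactSupport.of_compactSpace _)

/-- Differentiation under the integral sign over a compact space, when the derivative of the
integrand is jointly continuous near the base point. -/
theorem hasFDerivAt_integral_of_continuousOn_fderiv [NormedSpace ℝ E] [ProperSpace E] (μ : Measure K)
    [IsFiniteMeasure μ] {F : E → K → ℝ} {F' : E → K → E →L[ℝ] ℝ} {U : Set E} (hU : IsOpen U)
    (hF : ∀ y ∈ U, ∀ a, HasFDerivAt (F · a) (F' y a) y)
    (hFc : ∀ y ∈ U, Continuous (F y))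
    (hF'c : ContinuousOn (Function.uncurry F') (U ×ˢ Set.univ)) {x : E} (hx : x ∈ U) :
    HasFDerivAt (fun y => ∫ a, F y a ∂μ) (∫ a, F' x a ∂μ) x := by
  obtain ⟨r, hr, hrU⟩ := nhds_basis_closedBall.mem_iff.1 (hU.mem_nhds hx)
  obtain ⟨C, hC⟩ := ((isCompact_closedBall x r).prod isCompact_univ).exists_bound_of_continuousOn
    (hF'c.mono (Set.prod_mono hrU subset_rfl))
  have hF'x : Continuous (F' x) := by
    rw [← continuousOn_univ]
    exact hF'c.comp (f := fun a => (x, a)) (by fun_prop) fun a _ => ⟨hx, trivial⟩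
  refine hasFDerivAt_integral_of_dominated_of_fderiv_le (bound := fun _ => C)
    (closedBall_mem_nhds x hr) ?_ ?_ ?_ ?_ (integrable_const C) ?_
  · filter_upwards [hU.mem_nhds hx] with y hy
    exact (integrable_of_continuous_compactSpace μ (hFc y hy)).aestronglyMeasurable
  · exact integrable_of_continuous_compactSpace μ (hFc x hx)
  · exact (integrable_of_continuous_compactSpace μ hF'x).aestronglyMeasurable
  · exact .of_forall fun a y hy => hC (y, a) ⟨hy, trivial⟩
  · exact .of_forall fun a y hy => hF y (hrU hy) a

end ParametricIntegral

section Ball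

variable {E : Type*} [NormedAddCommGroup E]

theorem one_sub_norm_sq_pos {y : E} (hy : y ∈ ball (0 : E) 1) : 0 < 1 - ‖y‖ ^ 2 := by
  have h : ‖y‖ < 1 := by simpa using hy
  nlinarith [norm_nonneg y]

theorem norm_sub_sq_pos_of_mem_ball_sphere {y : E} (hy : y ∈ ball (0 : E) 1)
    (z : sphere (0 : E) 1) : 0 < ‖y - (z : E)‖ ^ 2 := by
  have h : ‖y‖ < 1 := by simpa using hy
  have hz : ‖(z : E)‖ = 1 := norm_eq_of_mem_sphere z
  have : y - (z : E) ≠ 0 := fun h0 => by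
    rw [sub_eq_zero.1 h0] at h
    exact h.ne hz
  positivity

theorem continuous_right_of_continuousOn_ball_prod {F : Type*} [TopologicalSpace F]
    {f : E → sphere (0 : E) 1 → F}
    (hf : ContinuousOn (Function.uncurry f) (ball 0 1 ×ˢ Set.univ)) {y : E}
    (hy : y ∈ ball (0 : E) 1) : Continuous (f y) := by
  rw [← continuousOn_univ]
  exact hf.comp (f := fun z => (y, z)) (by fun_prop) fun z _ => ⟨hy, trivial⟩

end Ball

section Kernel

variable {E : Type*} [NormedAddCommGroup E] [InnerProductSpace ℝ E]

/-- The derivative in `y` of `−(1/2) log((1−|y|²)/|y−z|²)`. -/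
def kernelFDeriv (y z : E) : E →L[ℝ] ℝ :=
  (1 - ‖y‖ ^ 2)⁻¹ • innerSL ℝ y + (‖y - z‖ ^ 2)⁻¹ • innerSL ℝ (y - z)

/-- The derivative in `y` of `kernelFDeriv y z v`. -/
def kernelFDeriv₂ (v y z : E) : E →L[ℝ] ℝ :=
  ((1 - ‖y‖ ^ 2)⁻¹ + (‖y - z‖ ^ 2)⁻¹) • innerSL ℝ v
    + (2 * ⟪y, v⟫ * ((1 - ‖y‖ ^ 2) ^ 2)⁻¹) • innerSL ℝ y
    - (2 * ⟪y - z, v⟫ * ((‖y - z‖ ^ 2) ^ 2)⁻¹) • innerSL ℝ (y - z)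

theorem hasFDerivAt_one_sub_norm_sq (y : E) :
    HasFDerivAt (fun y : E => 1 - ‖y‖ ^ 2) (-(2 • innerSL ℝ y)) y := by
  simpa using ((hasFDerivAt_id y).norm_sq).const_sub 1

theorem hasFDerivAt_norm_sub_sq (y z : E) :
    HasFDerivAt (fun y : E => ‖y - z‖ ^ 2) (2 • innerSL ℝ (y - z)) y := by
  simpa using ((hasFDerivAt_id y).sub_const z).norm_sq

theorem hasFDerivAt_kernel {y z : E} (hy : 1 - ‖y‖ ^ 2 ≠ 0) (hz : ‖y - z‖ ^ 2 ≠ 0) :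
    HasFDerivAt (fun y => -(1 / 2) * Real.log ((1 - ‖y‖ ^ 2) / ‖y - z‖ ^ 2))
      (kernelFDeriv y z) y := by
  have h := (((hasFDerivAt_one_sub_norm_sq y).log hy).sub
    ((hasFDerivAt_norm_sub_sq y z).log hz)).const_mul (-(1 / 2))
  have h1 : ∀ᶠ w in nhds y, 1 - ‖w‖ ^ 2 ≠ 0 :=
    (hasFDerivAt_one_sub_norm_sq y).continuousAt.eventually_ne hy
  have h2 : ∀ᶠ w in nhds y, ‖w - z‖ ^ 2 ≠ 0 :=
    (hasFDerivAt_norm_sub_sq y z).continuousAt.eventually_ne hz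
  refine (h.congr_of_eventuallyEq ?_).congr_fderiv ?_
  · filter_upwards [h1, h2] with w hw1 hw2
    simp [Real.log_div hw1 hw2]
  · ext w
    simp [kernelFDeriv]
    ring

theorem hasFDerivAt_kernelFDeriv_apply {y z : E} (v : E) (hy : 1 - ‖y‖ ^ 2 ≠ 0)
    (hz : ‖y - z‖ ^ 2 ≠ 0) :
    HasFDerivAt (fun y => kernelFDeriv y z v) (kernelFDeriv₂ v y z) y := by
  have hi1 := ((hasDerivAt_inv hy).comp_hasFDerivAt y (hasFDerivAt_one_sub_norm_sq y)).mul
    ((innerSL ℝ v).hasFDerivAt (x := y))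
  have hi2 := ((hasDerivAt_inv hz).comp_hasFDerivAt y (hasFDerivAt_norm_sub_sq y z)).mul
    ((innerSL ℝ v).hasFDerivAt.sub_const (x := y) ⟪v, z⟫)
  refine ((hi1.add hi2).congr_of_eventuallyEq (.of_forall fun w => ?_)).congr_fderiv ?_
  · simp [kernelFDeriv, real_inner_comm v]
  · ext w
    simp [kernelFDeriv₂, real_inner_comm v, inner_sub_right]
    ring

theorem continuousOn_kernelFDeriv :
    ContinuousOn (Function.uncurry fun (y : E) (z : sphere (0 : E) 1) => kernelFDeriv y (z : E))
      (ball 0 1 ×ˢ Set.univ) := by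
  have h1 : ∀ p ∈ ball (0 : E) 1 ×ˢ (Set.univ : Set (sphere (0 : E) 1)), 1 - ‖p.1‖ ^ 2 ≠ 0 :=
    fun p hp => (one_sub_norm_sq_pos hp.1).ne'
  have h2 : ∀ p ∈ ball (0 : E) 1 ×ˢ (Set.univ : Set (sphere (0 : E) 1)),
      ‖p.1 - (p.2 : E)‖ ^ 2 ≠ 0 :=
    fun p hp => (norm_sub_sq_pos_of_mem_ball_sphere hp.1 p.2).ne'
  unfold kernelFDeriv Function.uncurry
  fun_prop (disch := assumption)

theorem continuousOn_kernelFDeriv₂ (v : E) :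
    ContinuousOn (Function.uncurry fun (y : E) (z : sphere (0 : E) 1) =>
      kernelFDeriv₂ v y (z : E)) (ball 0 1 ×ˢ Set.univ) := by
  have h1 : ∀ p ∈ ball (0 : E) 1 ×ˢ (Set.univ : Set (sphere (0 : E) 1)),
      1 - ‖p.1‖ ^ 2 ≠ 0 :=
    fun p hp => (one_sub_norm_sq_pos hp.1).ne'
  have h2 : ∀ p ∈ ball (0 : E) 1 ×ˢ (Set.univ : Set (sphere (0 : E) 1)),
      ‖p.1 - (p.2 : E)‖ ^ 2 ≠ 0 :=
    fun p hp => (norm_sub_sq_pos_of_mem_ball_sphere hp.1 p.2).ne'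
  have h3 : ∀ p ∈ ball (0 : E) 1 ×ˢ (Set.univ : Set (sphere (0 : E) 1)),
      (1 - ‖p.1‖ ^ 2) ^ 2 ≠ 0 := fun p hp => pow_ne_zero 2 (h1 p hp)
  have h4 : ∀ p ∈ ball (0 : E) 1 ×ˢ (Set.univ : Set (sphere (0 : E) 1)),
      (‖p.1 - (p.2 : E)‖ ^ 2) ^ 2 ≠ 0 := fun p hp => pow_ne_zero 2 (h2 p hp)
  unfold kernelFDeriv₂ Function.uncurry
  fun_prop (disch := assumption)

end Kernel

/-- For `z` on the sphere, the hyperbolic Laplacian of `−(1/2) log((1−|x|²)/|x−z|²)` is `4`. -/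
theorem hyperbolic_laplacian_kernel {x : E3} (hx : x ∈ ball (0 : E3) 1)
    (z : sphere (0 : E3) 1) :
    (1 - ‖x‖ ^ 2) ^ 2 * ∑ i : Fin 3,
        kernelFDeriv₂ (EuclideanSpace.single i (1 : ℝ)) x (z : E3) (EuclideanSpace.single i 1)
      + 2 * (1 - ‖x‖ ^ 2) * kernelFDeriv x (z : E3) x = 4 := by
  have h1 := (one_sub_norm_sq_pos hx).ne'
  have h2 := (norm_sub_sq_pos_of_mem_ball_sphere hx z).ne'
  have hz : ‖(z : E3)‖ ^ 2 = 1 := by rw [norm_eq_of_mem_sphere z, one_pow]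
  have hs (w : E3) : ∑ i : Fin 3, w i * w i = ‖w‖ ^ 2 := by
    simp [EuclideanSpace.norm_sq_eq, ← sq]
  have hsum : ∑ i : Fin 3,
      kernelFDeriv₂ (EuclideanSpace.single i (1 : ℝ)) x (z : E3) (EuclideanSpace.single i 1)
      = 3 * ((1 - ‖x‖ ^ 2)⁻¹ + (‖x - z‖ ^ 2)⁻¹) + 2 * ((1 - ‖x‖ ^ 2) ^ 2)⁻¹ * ‖x‖ ^ 2
        - 2 * ((‖x - z‖ ^ 2) ^ 2)⁻¹ * ‖x - z‖ ^ 2 := by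
    have hterm (i : Fin 3) :
        kernelFDeriv₂ (EuclideanSpace.single i (1 : ℝ)) x (z : E3) (EuclideanSpace.single i 1)
        = ((1 - ‖x‖ ^ 2)⁻¹ + (‖x - z‖ ^ 2)⁻¹) + 2 * ((1 - ‖x‖ ^ 2) ^ 2)⁻¹ * (x i * x i)
          - 2 * ((‖x - z‖ ^ 2) ^ 2)⁻¹ * ((x - (z : E3)) i * (x - (z : E3)) i) := by
      simp [kernelFDeriv₂, EuclideanSpace.inner_single_right]
      ring
    simp_rw [hterm, Finset.sum_sub_distrib, Finset.sum_add_distrib, ← Finset.mul_sum, hs]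
    simp
    ring
  have hin : ⟪x - (z : E3), x⟫ = (‖x - z‖ ^ 2 - (1 - ‖x‖ ^ 2)) / 2 := by
    rw [norm_sub_sq_real, inner_sub_left, real_inner_self_eq_norm_sq, hz,
      real_inner_comm x (z : E3)]
    ring
  have hk : kernelFDeriv x (z : E3) x =
      (1 - ‖x‖ ^ 2)⁻¹ * ‖x‖ ^ 2
        + (‖x - z‖ ^ 2)⁻¹ * ((‖x - z‖ ^ 2 - (1 - ‖x‖ ^ 2)) / 2) := by
    rw [← hin]
    simp [kernelFDeriv, inner_sub_left]
  rw [hsum, hk]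
  generalize ‖x - (z : E3)‖ ^ 2 = D at *
  obtain ⟨A, hA⟩ : ∃ A, A = 1 - ‖x‖ ^ 2 := ⟨_, rfl⟩
  rw [show ‖x‖ ^ 2 = 1 - A by rw [hA]; ring, sub_sub_cancel]
  rw [← hA] at h1
  field_simp
  ring

/-- For a Borel probability measure `μ` on `S²` and the Douady–Earle function
`h_μ(x) = −(1/2)∫ log((1−|x|²)/|x−ζ|²) dμ(ζ)` on the open unit ball,
the hyperbolic Laplacian `(1−|x|²)²·Δh_μ(x) + 2(1−|x|²)·⟨x, ∇h_μ(x)⟩` equals `4`. -/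
theorem stmt_8
    (μ : Measure (sphere (0 : E3) 1)) [IsProbabilityMeasure μ]
    (hμ : E3 → ℝ)
    (hdef : hμ = fun x =>
      -(1 / 2) * ∫ ζ : sphere (0 : E3) 1,
        Real.log ((1 - ‖x‖ ^ 2) / ‖x - (ζ : E3)‖ ^ 2) ∂μ)
    (x : E3) (hx : ‖x‖ < 1) :
    (1 - ‖x‖ ^ 2) ^ 2 * eucLap hμ x + 2 * (1 - ‖x‖ ^ 2) * ⟪x, gradient hμ x⟫ = 4 := by
  have hxU : x ∈ ball (0 : E3) 1 := by simpa using hx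
  have hint₁ {y : E3} (hy : y ∈ ball (0 : E3) 1) :
      Integrable (fun z : sphere (0 : E3) 1 => kernelFDeriv y (z : E3)) μ :=
    integrable_of_continuous_compactSpace μ
      (continuous_right_of_continuousOn_ball_prod continuousOn_kernelFDeriv hy)
  have hint₂ (v : E3) : Integrable (fun z : sphere (0 : E3) 1 => kernelFDeriv₂ v x (z : E3)) μ :=
    integrable_of_continuous_compactSpace μ
      (continuous_right_of_continuousOn_ball_prod (continuousOn_kernelFDeriv₂ v) hxU)
  have hfd {y : E3} (hy : y ∈ ball (0 : E3) 1) (v : E3) :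
      fderiv ℝ hμ y v = ∫ z : sphere (0 : E3) 1, kernelFDeriv y (z : E3) v ∂μ := by
    rw [← ContinuousLinearMap.integral_apply (hint₁ hy)]
    congr 1
    simp_rw [hdef, ← integral_const_mul]
    refine (hasFDerivAt_integral_of_continuousOn_fderiv μ isOpen_ball
      (fun y hy z => hasFDerivAt_kernel (one_sub_norm_sq_pos hy).ne'
        (norm_sub_sq_pos_of_mem_ball_sphere hy z).ne')
      (fun y hy => ?_) continuousOn_kernelFDeriv hy).fderiv
    have h2 := fun z => (norm_sub_sq_pos_of_mem_ball_sphere hy z).ne'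
    have h3 := fun z => (div_ne_zero (one_sub_norm_sq_pos hy).ne' (h2 z))
    fun_prop (disch := assumption)
  have hdd (v : E3) :
      dd hμ x v = ∫ z : sphere (0 : E3) 1, kernelFDeriv₂ v x (z : E3) v ∂μ := by
    rw [← ContinuousLinearMap.integral_apply (hint₂ v), dd]
    congr 1
    have hev : (fun y => fderiv ℝ hμ y v) =ᶠ[nhds x]
        fun y => ∫ z : sphere (0 : E3) 1, kernelFDeriv y (z : E3) v ∂μ := by
      filter_upwards [isOpen_ball.mem_nhds hxU] with y hy using hfd hy v
    rw [hev.fderiv_eq]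
    exact (hasFDerivAt_integral_of_continuousOn_fderiv μ isOpen_ball
      (fun y hy z => hasFDerivAt_kernelFDeriv_apply v (one_sub_norm_sq_pos hy).ne'
        (norm_sub_sq_pos_of_mem_ball_sphere hy z).ne')
      (fun y hy => (continuous_right_of_continuousOn_ball_prod
        continuousOn_kernelFDeriv hy).clm_apply continuous_const)
      (continuousOn_kernelFDeriv₂ v) hxU).fderiv
  have hgrad : ⟪x, gradient hμ x⟫ = fderiv ℝ hμ x x := by
    rw [real_inner_comm, gradient, InnerProductSpace.toDual_symm_apply]
  have hint₃ (v : E3) := (hint₂ v).apply_continuousLinearMap v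
  rw [hgrad, hfd hxU, eucLap]
  simp_rw [hdd]
  rw [← integral_finsetSum _ fun i _ => hint₃ _, ← integral_const_mul, ← integral_const_mul,
    ← integral_add ((integrable_finsetSum _ fun i _ => hint₃ _).const_mul _)
      (((hint₁ hxU).apply_continuousLinearMap x).const_mul _)]
  simp_rw [hyperbolic_laplacian_kernel hxU]
  simp
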